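/- Let G be a finite graph with a percolation measure, let A = {a₁,a₂,a₃} and b be vertices, and for S ⊆ {1,2,3} set m_S := P(b↔a_s for all s∈S, b↮a_t for all t∉S). Suppose that for some j ∈ {1,2,3} we have m_{{j}} ≤ m_{{1,2,3}\{j}}. Then for every vertex 0, P(0↔b, 0↔A) ≥ min over a∈A of P(0↔A, a↔b). -/

import Mathlib

open scoped BigOperators

structure PercGraph (V E : Type) where
  ends : E → V × V
  p : E → ℝ

namespace PercGraph

variable {V E : Type} [DecidableEq V] [Fintype E] [DecidableEq E]

/-- Weight of a configuration: each edge `e` is open (`ω e = true`) with probability `p e`. -/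
def weight (G : PercGraph V E) (ω : E → Bool) : ℝ :=
  ∏ e, if ω e then G.p e else 1 - G.p e

/-- Probability of an event under the percolation measure. -/
noncomputable def prob (G : PercGraph V E) (S : Set (E → Bool)) : ℝ :=
  ∑ ω : E → Bool, Set.indicator S G.weight ω

/-- Expectation of a function under the percolation measure. -/
noncomputable def expec (G : PercGraph V E) (f : (E → Bool) → ℝ) : ℝ :=
  ∑ ω : E → Bool, f ω * G.weight ω

/-- Two vertices are adjacent via an open edge in configuration `ω`. -/
def adj (G : PercGraph V E) (ω : E → Bool) (x y : V) : Prop :=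
  ∃ e, ω e = true ∧ (G.ends e = (x, y) ∨ G.ends e = (y, x))

/-- `x` and `y` are connected by a path of open edges. -/
def Conn (G : PercGraph V E) (ω : E → Bool) (x y : V) : Prop :=
  Relation.ReflTransGen (G.adj ω) x y

/-- The union of the open clusters of the vertices of `A`. -/
def cluster (G : PercGraph V E) (ω : E → Bool) (A : Set V) : Set V :=
  {y | ∃ a ∈ A, G.Conn ω a y}

/-- The event `x ↔ y`. -/
def connEvent (G : PercGraph V E) (x y : V) : Set (E → Bool) :=
  {ω | G.Conn ω x y}

/-- The event `x ↔ A`. -/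
def connTo (G : PercGraph V E) (x : V) (A : Set V) : Set (E → Bool) :=
  {ω | ∃ a ∈ A, G.Conn ω x a}

/-- The event `A ↮ B`. -/
def disconn (G : PercGraph V E) (A B : Set V) : Set (E → Bool) :=
  {ω | ∀ a ∈ A, ∀ b ∈ B, ¬ G.Conn ω a b}

def IncreasingEvent (S : Set (E → Bool)) : Prop :=
  ∀ ⦃ω ω' : E → Bool⦄, (∀ e, ω e = true → ω' e = true) → ω ∈ S → ω' ∈ S

def DecreasingEvent (S : Set (E → Bool)) : Prop :=
  ∀ ⦃ω ω' : E → Bool⦄, (∀ e, ω e = true → ω' e = true) → ω' ∈ S → ω ∈ S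

def IncreasingFun (f : (E → Bool) → ℝ) : Prop :=
  ∀ ⦃ω ω' : E → Bool⦄, (∀ e, ω e = true → ω' e = true) → f ω ≤ f ω'

/-- `f` is determined by the cluster of `A`. -/
def ClusterDetermined (G : PercGraph V E) (A : Set V) (f : (E → Bool) → ℝ) : Prop :=
  ∀ ω ω', G.cluster ω A = G.cluster ω' A → f ω = f ω'

/-- The event `S` is determined by the cluster of `A`. -/
def ClusterDeterminedEvent (G : PercGraph V E) (A : Set V) (S : Set (E → Bool)) : Prop :=
  ∀ ω ω', G.cluster ω A = G.cluster ω' A → (ω ∈ S ↔ ω' ∈ S)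

noncomputable def condProb (G : PercGraph V E) (S T : Set (E → Bool)) : ℝ :=
  G.prob (S ∩ T) / G.prob T

noncomputable def condExpec (G : PercGraph V E) (f : (E → Bool) → ℝ) (T : Set (E → Bool)) : ℝ :=
  G.expec (T.indicator f) / G.prob T

/-- The edge `e` is incident to the vertex `x`. -/
def incident (G : PercGraph V E) (x : V) (e : E) : Prop :=
  (G.ends e).1 = x ∨ (G.ends e).2 = x

/-- The other endpoint of an edge incident to `x`. -/
def otherEnd (G : PercGraph V E) (x : V) (e : E) : V :=
  if (G.ends e).1 = x then (G.ends e).2 else (G.ends e).1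

/-- The graph `G ∖ W`: delete the vertices of `W` and all incident edges. -/
def delete (G : PercGraph V E) (W : Finset V) :
    PercGraph V {e : E // (G.ends e).1 ∉ W ∧ (G.ends e).2 ∉ W} :=
  ⟨fun e => G.ends e.1, fun e => G.p e.1⟩

/-- The graph `G` with the probability of edge `e` replaced by `q`. -/
def withEdgeProb (G : PercGraph V E) (e : E) (q : ℝ) : PercGraph V E :=
  ⟨G.ends, Function.update G.p e q⟩

/-- Contraction of the edge `e`: set its probability to 1. -/
def contract (G : PercGraph V E) (e : E) : PercGraph V E :=
  G.withEdgeProb e 1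

/-- The event that `e` is pivotal for `U`. -/
def pivotal (e : E) (U : Set (E → Bool)) : Set (E → Bool) :=
  {ω | ¬ ((Function.update ω e true ∈ U) ↔ (Function.update ω e false ∈ U))}

/-- All edge probabilities lie in `[0,1]`. -/
def ProbValid (G : PercGraph V E) : Prop := ∀ e, 0 ≤ G.p e ∧ G.p e ≤ 1

end PercGraph

namespace PercGraph

section Connectivity

variable {V E : Type}

/-- The configuration whose set of open edges is `X`. -/
def conf [DecidableEq E] (X : Finset E) : E → Bool := fun e => decide (e ∈ X)

theorem adj_conf [DecidableEq E] {G : PercGraph V E} {X : Finset E} {x y : V} :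
    G.adj (conf X) x y ↔ ∃ e ∈ X, G.ends e = (x, y) ∨ G.ends e = (y, x) := by
  simp [adj, conf]

theorem Conn.symm {G : PercGraph V E} {ω : E → Bool} {x y : V} (h : G.Conn ω x y) :
    G.Conn ω y x := by
  induction h with
  | refl => exact Relation.ReflTransGen.refl
  | tail _ hyz ih =>
    obtain ⟨e, he, h⟩ := hyz
    exact Relation.ReflTransGen.head ⟨e, he, h.symm⟩ ih

theorem Conn.trans {G : PercGraph V E} {ω : E → Bool} {x y z : V} (h : G.Conn ω x y)
    (h' : G.Conn ω y z) : G.Conn ω x z :=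
  Relation.ReflTransGen.trans h h'

variable [DecidableEq E]

theorem Conn.mono {G : PercGraph V E} {X Y : Finset E} (hXY : X ⊆ Y) {x y : V}
    (h : G.Conn (conf X) x y) : G.Conn (conf Y) x y := by
  induction h with
  | refl => exact Relation.ReflTransGen.refl
  | tail _ hyz ih =>
    obtain ⟨e, he, h⟩ := adj_conf.1 hyz
    exact ih.tail (adj_conf.2 ⟨e, hXY he, h⟩)

/-- The edge `e` has an endpoint in the cluster of `S` in the configuration `X`. -/
def Touches (G : PercGraph V E) (X : Finset E) (S : Set V) (e : E) : Prop :=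
  ∃ s ∈ S, G.Conn (conf X) s (G.ends e).1 ∨ G.Conn (conf X) s (G.ends e).2

/-- The sets `S` and `T` are not connected in the configuration `X`. -/
def Sep (G : PercGraph V E) (S T : Set V) (X : Finset E) : Prop :=
  ∀ s ∈ S, ∀ t ∈ T, ¬ G.Conn (conf X) s t

/-- The preorder on configurations for which the cluster of `S` grows and that of `T` shrinks. -/
def Dom (G : PercGraph V E) (S T : Set V) (X Y : Finset E) : Prop :=
  (∀ e ∈ X, G.Touches X S e → e ∈ Y) ∧ ∀ e ∈ Y, G.Touches Y T e → e ∈ X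

/-- Events inside `S ↮ T`, on configurations supported by `R`, that are increasing in the cluster
of `S` and decreasing in the cluster of `T`. -/
def ClusterMono (G : PercGraph V E) (R : Finset E) (S T : Set V) (F : Finset E → Prop) : Prop :=
  (∀ X ⊆ R, F X → G.Sep S T X) ∧ ∀ X ⊆ R, ∀ Y ⊆ R, G.Dom S T X Y → F X → F Y

theorem Conn.of_touches {G : PercGraph V E} {X Y : Finset E} {S : Set V} {s x : V} (hs : s ∈ S)
    (hXY : ∀ e ∈ X, G.Touches X S e → e ∈ Y) (h : G.Conn (conf X) s x) :
    G.Conn (conf Y) s x := by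
  induction h with
  | refl => exact Relation.ReflTransGen.refl
  | @tail y z hy hyz ih =>
    obtain ⟨e, he, h⟩ := adj_conf.1 hyz
    refine ih.tail (adj_conf.2 ⟨e, hXY e he ⟨s, hs, ?_⟩, h⟩)
    rcases h with h | h <;> rw [h]
    · exact Or.inl hy
    · exact Or.inr hy

theorem Dom.sep {G : PercGraph V E} {S T : Set V} {X Y : Finset E} (h : G.Dom S T X Y)
    (hX : G.Sep S T X) : G.Sep S T Y :=
  fun s hs t ht hst => hX s hs t ht (Conn.of_touches ht h.2 hst.symm).symm

theorem exists_conn_of_conn_insert {G : PercGraph V E} {X : Finset E} {S : Set V} {e : E}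
    {v w s x : V} (he : G.ends e = (v, w) ∨ G.ends e = (w, v)) (hv : v ∈ S) (hs : s ∈ S)
    (h : G.Conn (conf (insert e X)) s x) : ∃ s' ∈ insert w S, G.Conn (conf X) s' x := by
  induction h with
  | refl => exact ⟨s, Or.inr hs, Relation.ReflTransGen.refl⟩
  | @tail y z hy hyz ih =>
    obtain ⟨f, hf, h⟩ := adj_conf.1 hyz
    rcases Finset.mem_insert.1 hf with rfl | hf
    · refine ⟨z, ?_, Relation.ReflTransGen.refl⟩
      have : z = v ∨ z = w := by
        rcases he with he | he <;> rcases h with h | h <;> rw [he] at h <;> simp_all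
      rcases this with rfl | rfl
      · exact Or.inr hv
      · exact Or.inl rfl
    · obtain ⟨s', hs', h'⟩ := ih
      exact ⟨s', hs', h'.tail (adj_conf.2 ⟨f, hf, h⟩)⟩

theorem conn_of_conn_insert {G : PercGraph V E} {X : Finset E} {e : E} {v w t x : V}
    (he : G.ends e = (v, w) ∨ G.ends e = (w, v)) (hv : ¬ G.Conn (conf X) t v)
    (hw : ¬ G.Conn (conf X) t w) (h : G.Conn (conf (insert e X)) t x) : G.Conn (conf X) t x := by
  induction h with
  | refl => exact Relation.ReflTransGen.refl
  | @tail y z hy hyz ih =>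
    obtain ⟨f, hf, h⟩ := adj_conf.1 hyz
    rcases Finset.mem_insert.1 hf with rfl | hf
    · have : y = v ∨ y = w := by
        rcases he with he | he <;> rcases h with h | h <;> rw [he] at h <;> simp_all
      rcases this with rfl | rfl
      · exact absurd ih hv
      · exact absurd ih hw
    · exact ih.tail (adj_conf.2 ⟨f, hf, h⟩)

theorem conn_insert_self {G : PercGraph V E} {X : Finset E} {e : E} {v w : V}
    (he : G.ends e = (v, w) ∨ G.ends e = (w, v)) : G.Conn (conf (insert e X)) v w :=
  Relation.ReflTransGen.single (adj_conf.2 ⟨e, Finset.mem_insert_self e X, he⟩)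

theorem Sep.symm {G : PercGraph V E} {S T : Set V} {X : Finset E} (h : G.Sep S T X) :
    G.Sep T S X := fun t ht s hs hst => h s hs t ht hst.symm

theorem Sep.of_insert {G : PercGraph V E} {S T : Set V} {X : Finset E} {e : E} {v w : V}
    (he : G.ends e = (v, w) ∨ G.ends e = (w, v)) (hv : v ∈ S)
    (h : G.Sep S T (insert e X)) : G.Sep (insert w S) T X := by
  rintro s (rfl | hs) t ht hst
  · exact h v hv t ht ((conn_insert_self he).trans (hst.mono (Finset.subset_insert e X)))
  · exact h s hs t ht (hst.mono (Finset.subset_insert e X))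

theorem Sep.insert {G : PercGraph V E} {S T : Set V} {X : Finset E} {e : E} {v w : V}
    (he : G.ends e = (v, w) ∨ G.ends e = (w, v)) (hv : v ∈ S)
    (h : G.Sep (insert w S) T X) : G.Sep S T (insert e X) := by
  intro s hs t ht hst
  obtain ⟨s', hs', h'⟩ := exists_conn_of_conn_insert he hv hs hst
  exact h s' hs' t ht h'

theorem Touches.of_insert {G : PercGraph V E} {S : Set V} {X : Finset E} {e f : E} {v w : V}
    (he : G.ends e = (v, w) ∨ G.ends e = (w, v)) (hv : v ∈ S)
    (h : G.Touches (insert e X) S f) : G.Touches X (insert w S) f := by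
  obtain ⟨s, hs, h | h⟩ := h
  · obtain ⟨s', hs', h'⟩ := exists_conn_of_conn_insert he hv hs h
    exact ⟨s', hs', Or.inl h'⟩
  · obtain ⟨s', hs', h'⟩ := exists_conn_of_conn_insert he hv hs h
    exact ⟨s', hs', Or.inr h'⟩

theorem Touches.of_insert_of_sep {G : PercGraph V E} {S T : Set V} {X : Finset E} {e f : E}
    {v w : V} (he : G.ends e = (v, w) ∨ G.ends e = (w, v)) (hv : v ∈ S)
    (hsep : G.Sep (insert w S) T X) (h : G.Touches (insert e X) T f) : G.Touches X T f := by
  obtain ⟨t, ht, h⟩ := h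
  have h1 : ¬ G.Conn (conf X) t v := fun h' => hsep v (Or.inr hv) t ht h'.symm
  have h2 : ¬ G.Conn (conf X) t w := fun h' => hsep w (Or.inl rfl) t ht h'.symm
  exact ⟨t, ht, h.imp (conn_of_conn_insert he h1 h2) (conn_of_conn_insert he h1 h2)⟩

theorem not_touches_of_sep {G : PercGraph V E} {S T : Set V} {X : Finset E} {e : E}
    {v w : V} (he : G.ends e = (v, w) ∨ G.ends e = (w, v)) (hv : v ∈ S)
    (hsep : G.Sep S T (insert e X)) : ¬ G.Touches (insert e X) T e := by
  rintro ⟨t, ht, h⟩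
  have hvw := conn_insert_self (X := X) he
  have key : G.Conn (conf (insert e X)) t v := by
    rcases he with he | he <;> rw [he] at h <;> rcases h with h | h
    · exact h
    · exact h.trans hvw.symm
    · exact h.trans hvw.symm
    · exact h
  exact hsep v hv t ht key.symm

theorem ClusterMono.mono {G : PercGraph V E} {R R' : Finset E} {S T : Set V}
    {F : Finset E → Prop} (hF : G.ClusterMono R S T F) (hR : R' ⊆ R) : G.ClusterMono R' S T F :=
  ⟨fun X hX => hF.1 X (hX.trans hR), fun X hX Y hY => hF.2 X (hX.trans hR) Y (hY.trans hR)⟩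

theorem ClusterMono.insert_left {G : PercGraph V E} {R : Finset E} {S T : Set V}
    {F : Finset E → Prop} {e : E} {v w : V} (he : G.ends e = (v, w) ∨ G.ends e = (w, v))
    (hv : v ∈ S) (hF : G.ClusterMono (insert e R) S T F) :
    G.ClusterMono R (insert w S) T (fun X => F (insert e X)) := by
  refine ⟨fun X hX h => (hF.1 _ (Finset.insert_subset_insert e hX) h).of_insert he hv,
    fun X hX Y hY hXY h => ?_⟩
  have hX' := Finset.insert_subset_insert e hX
  have hsX := (hF.1 _ hX' h).of_insert he hv
  have hsY := hXY.sep hsX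
  refine hF.2 _ hX' _ (Finset.insert_subset_insert e hY) ⟨fun f hf ht => ?_, fun f hf ht => ?_⟩ h
  · rcases Finset.mem_insert.1 hf with rfl | hf
    · exact Finset.mem_insert_self _ _
    · exact Finset.mem_insert_of_mem (hXY.1 f hf (ht.of_insert he hv))
  · rcases Finset.mem_insert.1 hf with rfl | hf
    · exact Finset.mem_insert_self _ _
    · exact Finset.mem_insert_of_mem (hXY.2 f hf (ht.of_insert_of_sep he hv hsY))

theorem ClusterMono.insert_right {G : PercGraph V E} {R : Finset E} {S T : Set V}
    {F : Finset E → Prop} {e : E} {v w : V} (he : G.ends e = (v, w) ∨ G.ends e = (w, v))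
    (hv : v ∈ T) (hF : G.ClusterMono (insert e R) S T F) :
    G.ClusterMono R S (insert w T) (fun X => F (insert e X)) := by
  refine ⟨fun X hX h => ((hF.1 _ (Finset.insert_subset_insert e hX) h).symm.of_insert he hv).symm,
    fun X hX Y hY hXY h => ?_⟩
  have hX' := Finset.insert_subset_insert e hX
  have hsX := (hF.1 _ hX' h).symm.of_insert he hv
  refine hF.2 _ hX' _ (Finset.insert_subset_insert e hY) ⟨fun f hf ht => ?_, fun f hf ht => ?_⟩ h
  · rcases Finset.mem_insert.1 hf with rfl | hf
    · exact Finset.mem_insert_self _ _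
    · exact Finset.mem_insert_of_mem (hXY.1 f hf (ht.of_insert_of_sep he hv hsX))
  · rcases Finset.mem_insert.1 hf with rfl | hf
    · exact Finset.mem_insert_self _ _
    · exact Finset.mem_insert_of_mem (hXY.2 f hf (ht.of_insert he hv))

theorem ClusterMono.of_insert_right {G : PercGraph V E} {R : Finset E} {S T : Set V}
    {F : Finset E → Prop} {e : E} {v w : V} (he : G.ends e = (v, w) ∨ G.ends e = (w, v))
    (hv : v ∈ T) (hF : G.ClusterMono (insert e R) S T F) {X : Finset E} (hX : X ⊆ R)
    (h : F (insert e X)) : F X := by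
  have hX' := Finset.insert_subset_insert e hX
  refine hF.2 _ hX' X (hX.trans (Finset.subset_insert e R))
    ⟨fun f hf ht => ?_, fun f hf _ => Finset.mem_insert_of_mem hf⟩ h
  rcases Finset.mem_insert.1 hf with rfl | hf
  · exact absurd ht (not_touches_of_sep he hv (hF.1 _ hX' h).symm)
  · exact hf

theorem ClusterMono.of_sep_insert {G : PercGraph V E} {R : Finset E} {S T : Set V}
    {F : Finset E → Prop} {e : E} {v w : V} (he : G.ends e = (v, w) ∨ G.ends e = (w, v))
    (hv : v ∈ S) (hF : G.ClusterMono (insert e R) S T F) {X : Finset E} (hX : X ⊆ R)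
    (hw : ∀ t ∈ T, ¬ G.Conn (conf X) w t) (h : F X) : F (insert e X) := by
  have hX' := hX.trans (Finset.subset_insert e R)
  have hsep : G.Sep (insert w S) T X := by
    rintro s (rfl | hs)
    · exact hw
    · exact hF.1 X hX' h s hs
  refine hF.2 X hX' _ (Finset.insert_subset_insert e hX)
    ⟨fun f hf _ => Finset.mem_insert_of_mem hf, fun f hf ht => ?_⟩ h
  rcases Finset.mem_insert.1 hf with rfl | hf
  · exact absurd ht (not_touches_of_sep he hv (hsep.insert he hv))
  · exact hf

theorem eq_of_conn_of_isolated {G : PercGraph V E} {X : Finset E} {t x : V}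
    (hiso : ∀ e ∈ X, ∀ w, ¬ (G.ends e = (t, w) ∨ G.ends e = (w, t)))
    (h : G.Conn (conf X) t x) : t = x := by
  induction h with
  | refl => rfl
  | @tail y z _ hyz ih =>
    subst ih
    obtain ⟨f, hf, h⟩ := adj_conf.1 hyz
    exact absurd h (hiso f hf z)

theorem ClusterMono.increasing_of_isolated {G : PercGraph V E} {R : Finset E} {S T : Set V}
    {F : Finset E → Prop} (hF : G.ClusterMono R S T F)
    (hiso : ∀ t ∈ T, ∀ e ∈ R, ∀ w, ¬ (G.ends e = (t, w) ∨ G.ends e = (w, t)))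
    {X Y : Finset E} (hXY : X ⊆ Y) (hY : Y ⊆ R) (h : F X) : F Y := by
  refine hF.2 X (hXY.trans hY) Y hY ⟨fun f hf _ => hXY hf, fun f hf ht => ?_⟩ h
  obtain ⟨t, ht, h⟩ := ht
  exfalso
  have hiso' := fun e he => hiso t ht e (hY he)
  rcases h with h | h
  · exact hiso t ht f (hY hf) (G.ends f).2 (Or.inl (by rw [eq_of_conn_of_isolated hiso' h]))
  · exact hiso t ht f (hY hf) (G.ends f).1 (Or.inr (by rw [eq_of_conn_of_isolated hiso' h]))

end Connectivity

section Probability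

variable {V E : Type} [DecidableEq E]

open Classical in
/-- Probability of an event when only the edges of `R` can be open. -/
noncomputable def probOn (G : PercGraph V E) (R : Finset E) (U : Finset E → Prop) : ℝ :=
  ∑ X ∈ R.powerset, if U X then ∏ e ∈ R, (if e ∈ X then G.p e else 1 - G.p e) else 0

theorem probOn_insert (G : PercGraph V E) {R : Finset E} {e : E} (he : e ∉ R)
    (U : Finset E → Prop) :
    G.probOn (insert e R) U =
      (1 - G.p e) * G.probOn R U + G.p e * G.probOn R (fun X => U (insert e X)) := by
  classical
  unfold probOn
  rw [Finset.sum_powerset_insert he, Finset.mul_sum, Finset.mul_sum]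
  congr 1
  · refine Finset.sum_congr rfl fun X hX => ?_
    have heX : e ∉ X := fun h => he (Finset.mem_powerset.1 hX h)
    rw [Finset.prod_insert he, if_neg heX, mul_ite, mul_zero]
  · refine Finset.sum_congr rfl fun X hX => ?_
    rw [Finset.prod_insert he, if_pos (Finset.mem_insert_self e X), mul_ite, mul_zero]
    congr 2
    refine Finset.prod_congr rfl fun f hf => ?_
    have hfe : f ≠ e := fun h => he (h ▸ hf)
    simp [hfe]

theorem probOn_mono {G : PercGraph V E} [Fintype E] (hp : G.ProbValid) {R : Finset E}
    {U U' : Finset E → Prop} (h : ∀ X ⊆ R, U X → U' X) : G.probOn R U ≤ G.probOn R U' := by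
  classical
  refine Finset.sum_le_sum fun X hX => ?_
  have h0 : 0 ≤ ∏ e ∈ R, (if e ∈ X then G.p e else 1 - G.p e) :=
    Finset.prod_nonneg fun e _ => by
      split_ifs
      · exact (hp e).1
      · linarith [(hp e).2]
  by_cases hU : U X
  · rw [if_pos hU, if_pos (h X (Finset.mem_powerset.1 hX) hU)]
  · rw [if_neg hU]
    split_ifs
    · exact h0
    · exact le_rfl

theorem probOn_false (G : PercGraph V E) (R : Finset E) : G.probOn R (fun _ => False) = 0 := by
  simp [probOn]

theorem probOn_nonneg {G : PercGraph V E} [Fintype E] (hp : G.ProbValid) (R : Finset E)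
    (U : Finset E → Prop) : 0 ≤ G.probOn R U := by
  rw [← probOn_false G R]
  exact probOn_mono hp fun _ _ h => h.elim

theorem probOn_congr {G : PercGraph V E} {R : Finset E} {U U' : Finset E → Prop}
    (h : ∀ X ⊆ R, U X ↔ U' X) : G.probOn R U = G.probOn R U' := by
  classical
  refine Finset.sum_congr rfl fun X hX => ?_
  simp only [h X (Finset.mem_powerset.1 hX)]

theorem probOn_add (G : PercGraph V E) (R : Finset E) (U U' : Finset E → Prop) :
    G.probOn R (fun X => U X ∧ U' X) + G.probOn R (fun X => U X ∧ ¬ U' X) = G.probOn R U := by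
  classical
  unfold probOn
  rw [← Finset.sum_add_distrib]
  refine Finset.sum_congr rfl fun X _ => ?_
  by_cases h : U X <;> by_cases h' : U' X <;> simp [h, h']

theorem probOn_true (G : PercGraph V E) (R : Finset E) : G.probOn R (fun _ => True) = 1 := by
  induction R using Finset.induction_on with
  | empty => simp [probOn]
  | insert e R he ih => rw [probOn_insert G he, ih]; ring

theorem prob_eq_probOn [Fintype E] (G : PercGraph V E) (S : Set (E → Bool)) :
    G.prob S = G.probOn Finset.univ (fun X => conf X ∈ S) := by
  classical
  unfold prob probOn
  refine Finset.sum_bij' (fun ω _ => Finset.univ.filter fun e => ω e = true) (fun X _ => conf X)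
    ?_ ?_ ?_ ?_ ?_
  · simp
  · simp
  · intro ω _
    funext e
    simp [conf]
  · intro X _
    ext e
    simp [conf]
  · intro ω _
    have h : conf (Finset.univ.filter fun e => ω e = true) = ω := by
      funext e
      simp [conf]
    simp only [h, Set.indicator_apply]
    simp [weight]

/-- Harris' inequality. -/
theorem probOn_mul_le_of_increasing {G : PercGraph V E} [Fintype E] (hp : G.ProbValid)
    (R : Finset E) (F₁ F₂ : Finset E → Prop)
    (h₁ : ∀ X Y, X ⊆ Y → Y ⊆ R → F₁ X → F₁ Y) (h₂ : ∀ X Y, X ⊆ Y → Y ⊆ R → F₂ X → F₂ Y) :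
    G.probOn R F₁ * G.probOn R F₂ ≤ G.probOn R (fun X => F₁ X ∧ F₂ X) := by
  induction R using Finset.induction_on generalizing F₁ F₂ with
  | empty =>
    simp only [probOn, Finset.powerset_empty, Finset.sum_singleton, Finset.prod_empty]
    by_cases h : F₁ ∅ <;> by_cases h' : F₂ ∅ <;> simp [h, h']
  | insert e R he ih =>
    have hsub := Finset.subset_insert e R
    have i0 := ih F₁ F₂ (fun X Y hXY hY => h₁ X Y hXY (hY.trans hsub))
      (fun X Y hXY hY => h₂ X Y hXY (hY.trans hsub))
    have i1 := ih (fun X => F₁ (insert e X)) (fun X => F₂ (insert e X))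
      (fun X Y hXY hY => h₁ _ _ (Finset.insert_subset_insert e hXY)
        (Finset.insert_subset_insert e hY))
      (fun X Y hXY hY => h₂ _ _ (Finset.insert_subset_insert e hXY)
        (Finset.insert_subset_insert e hY))
    have m1 : G.probOn R F₁ ≤ G.probOn R (fun X => F₁ (insert e X)) := probOn_mono hp
      fun X hX => h₁ _ _ (Finset.subset_insert e X) (Finset.insert_subset_insert e hX)
    have m2 : G.probOn R F₂ ≤ G.probOn R (fun X => F₂ (insert e X)) := probOn_mono hp
      fun X hX => h₂ _ _ (Finset.subset_insert e X) (Finset.insert_subset_insert e hX)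
    rw [probOn_insert G he, probOn_insert G he, probOn_insert G he]
    obtain ⟨hp0, hp1⟩ := hp e
    have hq : 0 ≤ 1 - G.p e := by linarith
    nlinarith [mul_nonneg (mul_nonneg hp0 hq) (mul_nonneg (sub_nonneg.2 m1) (sub_nonneg.2 m2)),
      mul_le_mul_of_nonneg_left i0 hq, mul_le_mul_of_nonneg_left i1 hp0]

theorem probOn_mul_le_of_clusterMono {G : PercGraph V E} [Fintype E] (hp : G.ProbValid)
    (R : Finset E) (S₁ S₂ T : Set V) (F₁ F₂ : Finset E → Prop)
    (h₁ : G.ClusterMono R S₁ T F₁) (h₂ : G.ClusterMono R S₂ T F₂) :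
    G.probOn R F₁ * G.probOn R F₂ ≤ G.probOn R (fun X => F₁ X ∧ F₂ X) := by
  induction R using Finset.strongInduction generalizing T F₁ F₂ with
  | H R' ih =>
    by_cases hiso : ∀ t ∈ T, ∀ e ∈ R', ∀ w, ¬ (G.ends e = (t, w) ∨ G.ends e = (w, t))
    · exact probOn_mul_le_of_increasing hp R' F₁ F₂
        (fun X Y hXY hY => h₁.increasing_of_isolated hiso hXY hY)
        (fun X Y hXY hY => h₂.increasing_of_isolated hiso hXY hY)
    push Not at hiso
    obtain ⟨t, ht, e, heR, w, hew⟩ := hiso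
    obtain ⟨R, he, rfl⟩ : ∃ R, e ∉ R ∧ insert e R = R' :=
      ⟨R'.erase e, Finset.notMem_erase e R', Finset.insert_erase heR⟩
    have hlt : R ⊂ insert e R := Finset.ssubset_insert he
    have i0 := ih R hlt T F₁ F₂ (h₁.mono hlt.1) (h₂.mono hlt.1)
    have i1 := ih R hlt (insert w T) _ _ (h₁.insert_right hew ht) (h₂.insert_right hew ht)
    have m1 : G.probOn R (fun X => F₁ (insert e X)) ≤ G.probOn R F₁ :=
      probOn_mono hp fun X hX => h₁.of_insert_right hew ht hX
    have m2 : G.probOn R (fun X => F₂ (insert e X)) ≤ G.probOn R F₂ :=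
      probOn_mono hp fun X hX => h₂.of_insert_right hew ht hX
    rw [probOn_insert G he, probOn_insert G he, probOn_insert G he]
    obtain ⟨hp0, hp1⟩ := hp e
    have hq : 0 ≤ 1 - G.p e := by linarith
    nlinarith [mul_nonneg (mul_nonneg hp0 hq) (mul_nonneg (sub_nonneg.2 m1) (sub_nonneg.2 m2)),
      mul_le_mul_of_nonneg_left i0 hq, mul_le_mul_of_nonneg_left i1 hp0]

/-- The four functions inequality on a two-point lattice. -/
theorem four_functions_two_point {p a₀ a₁ b₀ b₁ c₀ c₁ d₀ d₁ : ℝ} (hp₀ : 0 ≤ p) (hp₁ : p ≤ 1)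
    (ha₁ : 0 ≤ a₁) (hb₁ : 0 ≤ b₁)
    (hc₀ : 0 ≤ c₀) (hc₁ : 0 ≤ c₁) (hd₀ : 0 ≤ d₀) (hd₁ : 0 ≤ d₁)
    (h₀₀ : a₀ * b₀ ≤ c₀ * d₀) (h₁₀ : a₁ * b₀ ≤ c₁ * d₀) (h₀₁ : a₀ * b₁ ≤ c₁ * d₀)
    (h₁₁ : a₁ * b₁ ≤ c₁ * d₁) :
    ((1 - p) * a₀ + p * a₁) * ((1 - p) * b₀ + p * b₁) ≤
      ((1 - p) * c₀ + p * c₁) * ((1 - p) * d₀ + p * d₁) := by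
  have hq : 0 ≤ 1 - p := by linarith
  have cross : a₁ * b₀ + a₀ * b₁ ≤ c₁ * d₀ + c₀ * d₁ := by
    have hM : 0 ≤ c₁ * d₀ := by positivity
    have hN : 0 ≤ c₀ * d₁ := by positivity
    rcases hM.eq_or_lt with hM | hM
    · linarith
    have hxy : (a₀ * b₀) * (a₁ * b₁) ≤ (c₀ * d₀) * (c₁ * d₁) :=
      mul_le_mul h₀₀ h₁₁ (by positivity) (by positivity)
    refine le_of_mul_le_mul_left ?_ hM
    nlinarith [mul_nonneg (sub_nonneg.2 h₁₀) (sub_nonneg.2 h₀₁)]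
  nlinarith [mul_le_mul_of_nonneg_left h₀₀ (mul_nonneg hq hq),
    mul_le_mul_of_nonneg_left h₁₁ (mul_nonneg hp₀ hp₀),
    mul_le_mul_of_nonneg_left cross (mul_nonneg hp₀ hq)]

/-- The van den Berg–Häggström–Kahn inequality, for two source sets. -/
theorem probOn_mul_le_mul_sep {G : PercGraph V E} [Fintype E] (hp : G.ProbValid)
    (R : Finset E) (S₁ S₂ T : Set V) (F₁ F₂ : Finset E → Prop)
    (h₁ : G.ClusterMono R S₁ T F₁) (h₂ : G.ClusterMono R S₂ T F₂) :
    G.probOn R F₁ * G.probOn R F₂ ≤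
      G.probOn R (fun X => F₁ X ∧ F₂ X) * G.probOn R (G.Sep (S₁ ∩ S₂) T) := by
  induction R using Finset.strongInduction generalizing S₁ S₂ F₁ F₂ with
  | H R' ih =>
    by_cases hiso : ∀ s ∈ S₁ ∩ S₂, ∀ e ∈ R', ∀ w, ¬ (G.ends e = (s, w) ∨ G.ends e = (w, s))
    · by_cases hST : ∃ s ∈ S₁ ∩ S₂, s ∈ T
      · obtain ⟨s, hs, hsT⟩ := hST
        have h0 : G.probOn R' F₁ = 0 := by
          rw [← probOn_false G R']
          exact probOn_congr fun X hX =>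
            ⟨fun h => h₁.1 X hX h s hs.1 s hsT Relation.ReflTransGen.refl, False.elim⟩
        rw [h0, zero_mul]
        exact mul_nonneg (probOn_nonneg hp _ _) (probOn_nonneg hp _ _)
      · have h1 : G.probOn R' (G.Sep (S₁ ∩ S₂) T) = 1 := by
          rw [← probOn_true G R']
          refine probOn_congr fun X hX => ⟨fun _ => trivial, fun _ s hs t ht hst => hST ⟨s, hs, ?_⟩⟩
          rwa [eq_of_conn_of_isolated (fun e he => hiso s hs e (hX he)) hst]
        rw [h1, mul_one]
        exact probOn_mul_le_of_clusterMono hp R' S₁ S₂ T F₁ F₂ h₁ h₂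
    push Not at hiso
    obtain ⟨v, hv, e, heR, w, hew⟩ := hiso
    obtain ⟨R, he, rfl⟩ : ∃ R, e ∉ R ∧ insert e R = R' :=
      ⟨R'.erase e, Finset.notMem_erase e R', Finset.insert_erase heR⟩
    have hlt : R ⊂ insert e R := Finset.ssubset_insert he
    have k₁ := h₁.mono hlt.1
    have k₂ := h₂.mono hlt.1
    have l₁ := h₁.insert_left hew hv.1
    have l₂ := h₂.insert_left hew hv.2
    have i00 := ih R hlt S₁ S₂ F₁ F₂ k₁ k₂
    have i10 := ih R hlt _ S₂ _ F₂ l₁ k₂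
    have i01 := ih R hlt S₁ _ F₁ _ k₁ l₂
    have i11 := ih R hlt _ _ _ _ l₁ l₂
    rw [probOn_insert G he, probOn_insert G he, probOn_insert G he, probOn_insert G he]
    have nn : ∀ U, 0 ≤ G.probOn R U := probOn_nonneg hp R
    refine four_functions_two_point (hp e).1 (hp e).2 (nn _) (nn _) (nn _) (nn _) (nn _) (nn _)
      i00 (i10.trans ?_) (i01.trans ?_) (i11.trans ?_)
    · refine mul_le_mul (probOn_mono hp fun X hX h => ⟨h.1, ?_⟩)
        (probOn_mono hp fun X _ h s hs => h s ⟨Or.inr hs.1, hs.2⟩) (nn _) (nn _)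
      exact h₂.of_sep_insert hew hv.2 hX (l₁.1 X hX h.1 w (Or.inl rfl)) h.2
    · refine mul_le_mul (probOn_mono hp fun X hX h => ⟨?_, h.2⟩)
        (probOn_mono hp fun X _ h s hs => h s ⟨hs.1, Or.inr hs.2⟩) (nn _) (nn _)
      exact h₁.of_sep_insert hew hv.1 hX (l₂.1 X hX h.2 w (Or.inl rfl)) h.1
    · refine mul_le_mul_of_nonneg_left (probOn_mono hp fun X _ h => ?_) (nn _)
      rw [← Set.insert_inter_distrib] at h
      exact Sep.insert hew hv h

end Probability

section ThreePoints

variable {V E : Type} [DecidableEq E]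

theorem clusterMono_sep_and {G : PercGraph V E} {R : Finset E} {S T : Set V}
    {Q : Finset E → Prop} (hQ : ∀ X Y, G.Dom S T X Y → Q X → Q Y) :
    G.ClusterMono R S T (fun X => G.Sep S T X ∧ Q X) :=
  ⟨fun _ _ h => h.1, fun X _ Y _ hXY h => ⟨hXY.sep h.1, hQ X Y hXY h.2⟩⟩

theorem Dom.conn_left {G : PercGraph V E} {S T : Set V} {X Y : Finset E} (h : G.Dom S T X Y)
    {s x : V} (hs : s ∈ S) (hx : G.Conn (conf X) x s) : G.Conn (conf Y) x s :=
  (Conn.of_touches hs h.1 hx.symm).symm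

theorem Dom.conn_right {G : PercGraph V E} {S T : Set V} {X Y : Finset E} (h : G.Dom S T X Y)
    {t x : V} (ht : t ∈ T) (hx : G.Conn (conf Y) x t) : G.Conn (conf X) x t :=
  (Conn.of_touches ht h.2 hx.symm).symm

variable [Fintype E]

theorem probOn_mul_le_and_mul {G : PercGraph V E} (hp : G.ProbValid) {R : Finset E} {S T : Set V}
    {Q₁ Q₂ : Finset E → Prop} (h₁ : ∀ X Y, G.Dom S T X Y → Q₁ X → Q₁ Y)
    (h₂ : ∀ X Y, G.Dom S T X Y → Q₂ X → Q₂ Y) :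
    G.probOn R (fun X => G.Sep S T X ∧ Q₁ X) * G.probOn R (fun X => G.Sep S T X ∧ Q₂ X) ≤
      G.probOn R (fun X => (G.Sep S T X ∧ Q₁ X) ∧ Q₂ X) * G.probOn R (G.Sep S T) := by
  have h := probOn_mul_le_mul_sep hp R S S T _ _ (clusterMono_sep_and h₁) (clusterMono_sep_and h₂)
  rw [Set.inter_self] at h
  refine h.trans (mul_le_mul_of_nonneg_right ?_ (probOn_nonneg hp _ _))
  exact probOn_mono hp fun X _ h => ⟨h.1, h.2.2⟩

theorem probOn_and_not_mul_le {G : PercGraph V E} (hp : G.ProbValid) {R : Finset E} {S T : Set V}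
    {Q₁ Q₂ : Finset E → Prop} (h₁ : ∀ X Y, G.Dom S T X Y → Q₁ X → Q₁ Y)
    (h₂ : ∀ X Y, G.Dom S T X Y → Q₂ X → Q₂ Y) :
    G.probOn R (fun X => (G.Sep S T X ∧ Q₁ X) ∧ ¬ Q₂ X) * G.probOn R (G.Sep S T) ≤
      G.probOn R (fun X => G.Sep S T X ∧ Q₁ X) *
        G.probOn R (fun X => G.Sep S T X ∧ ¬ Q₂ X) := by
  have h := probOn_mul_le_and_mul hp (R := R) h₁ h₂
  rw [← probOn_add G R (G.Sep S T) Q₂] at h ⊢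
  rw [← probOn_add G R (fun X => G.Sep S T X ∧ Q₁ X) Q₂] at h ⊢
  nlinarith

theorem single_vs_pair {G : PercGraph V E} (hp : G.ProbValid) (R : Finset E) (u v w b x : V) :
    G.probOn R (fun X => G.Sep {v} {u, w} X ∧ G.Conn (conf X) x v) *
        G.probOn R (fun X => G.Sep {v} {u, w} X ∧ G.Conn (conf X) b v) ≤
      G.probOn R (fun X => (G.Sep {v} {u, w} X ∧ G.Conn (conf X) x v) ∧ G.Conn (conf X) b v) *
        G.probOn R (G.Sep {v} {u, w}) ∧
    G.probOn R (fun X => (G.Sep {v} {u, w} X ∧ G.Conn (conf X) x v) ∧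
          ¬ ¬ (G.Conn (conf X) b u ∧ G.Conn (conf X) b w)) * G.probOn R (G.Sep {v} {u, w}) ≤
      G.probOn R (fun X => G.Sep {v} {u, w} X ∧ G.Conn (conf X) x v) *
        G.probOn R (fun X => G.Sep {v} {u, w} X ∧
          ¬ ¬ (G.Conn (conf X) b u ∧ G.Conn (conf X) b w)) ∧
    G.probOn R (fun X => G.Sep {v} {u, w} X ∧ G.Conn (conf X) x v) *
        G.probOn R (fun X => G.Sep {v} {u, w} X ∧ ¬ G.Conn (conf X) u w) ≤
      G.probOn R (fun X => (G.Sep {v} {u, w} X ∧ G.Conn (conf X) x v) ∧ ¬ G.Conn (conf X) u w) *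
        G.probOn R (G.Sep {v} {u, w}) := by
  refine ⟨probOn_mul_le_and_mul hp ?_ ?_, probOn_and_not_mul_le hp ?_ ?_,
    probOn_mul_le_and_mul hp ?_ ?_⟩ <;> intro X Y h
  · exact h.conn_left (by simp)
  · exact h.conn_left (by simp)
  · exact h.conn_left (by simp)
  · exact mt (And.imp (h.conn_right (by simp)) (h.conn_right (by simp)))
  · exact h.conn_left (by simp)
  · exact mt (h.conn_right (by simp))

theorem pair_vs_single {G : PercGraph V E} (hp : G.ProbValid) (R : Finset E) (u v w b x : V) :
    G.probOn R (fun X => G.Sep {v, w} {u} X ∧ (G.Conn (conf X) x v ∨ G.Conn (conf X) x w)) *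
        G.probOn R (fun X => G.Sep {v, w} {u} X ∧ (G.Conn (conf X) b v ∧ G.Conn (conf X) b w)) ≤
      G.probOn R (fun X => (G.Sep {v, w} {u} X ∧ (G.Conn (conf X) x v ∨ G.Conn (conf X) x w)) ∧
          (G.Conn (conf X) b v ∧ G.Conn (conf X) b w)) *
        G.probOn R (G.Sep {v, w} {u}) ∧
    G.probOn R (fun X => (G.Sep {v, w} {u} X ∧ (G.Conn (conf X) x v ∨ G.Conn (conf X) x w)) ∧
          ¬ ¬ G.Conn (conf X) b u) * G.probOn R (G.Sep {v, w} {u}) ≤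
      G.probOn R (fun X => G.Sep {v, w} {u} X ∧ (G.Conn (conf X) x v ∨ G.Conn (conf X) x w)) *
        G.probOn R (fun X => G.Sep {v, w} {u} X ∧ ¬ ¬ G.Conn (conf X) b u) ∧
    G.probOn R (fun X => (G.Sep {v, w} {u} X ∧ (G.Conn (conf X) x v ∨ G.Conn (conf X) x w)) ∧
          ¬ G.Conn (conf X) v w) * G.probOn R (G.Sep {v, w} {u}) ≤
      G.probOn R (fun X => G.Sep {v, w} {u} X ∧ (G.Conn (conf X) x v ∨ G.Conn (conf X) x w)) *
        G.probOn R (fun X => G.Sep {v, w} {u} X ∧ ¬ G.Conn (conf X) v w) := by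
  refine ⟨probOn_mul_le_and_mul hp ?_ ?_, probOn_and_not_mul_le hp ?_ ?_,
    probOn_and_not_mul_le hp ?_ ?_⟩ <;> intro X Y h
  · exact Or.imp (h.conn_left (by simp)) (h.conn_left (by simp))
  · exact And.imp (h.conn_left (by simp)) (h.conn_left (by simp))
  · exact Or.imp (h.conn_left (by simp)) (h.conn_left (by simp))
  · exact mt (h.conn_right (by simp))
  · exact Or.imp (h.conn_left (by simp)) (h.conn_left (by simp))
  · exact h.conn_left (by simp)

theorem sep_mul_sep_le {G : PercGraph V E} (hp : G.ProbValid) (R : Finset E) (u v w : V) :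
    G.probOn R (G.Sep {v, w} {u}) * G.probOn R (G.Sep {v} {u, w}) ≤
      G.probOn R (fun X => G.Sep {v, w} {u} X ∧ G.Sep {v} {u, w} X) := by
  refine probOn_mul_le_of_clusterMono hp R ∅ ∅ {u, v, w} _ _ ?_ ?_
  all_goals
    refine ⟨fun X _ _ s hs => hs.elim, fun X _ Y _ h hX s hs t ht hst => hX s hs t ht ?_⟩
    refine h.conn_right ?_ hst
    simp only [Set.mem_insert_iff, Set.mem_singleton_iff] at ht ⊢
    tauto

theorem sum_le_sum_of_ratio_bounds
    {Pu Pv Pw Nu Nv Nw z zv zw mu mv mw muv muw mvw x₁ x₂ x₃ y₁ y₂ y₃ : ℝ}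
    (hPu : 0 ≤ Pu) (hPv : 0 ≤ Pv) (hPw : 0 ≤ Pw) (hNv : 0 ≤ Nv) (hNw : 0 ≤ Nw) (hz : 0 ≤ z)
    (hx₁ : 0 ≤ x₁) (hx₂ : 0 ≤ x₂) (hx₃ : 0 ≤ x₃) (hmu : 0 ≤ mu)
    (hNu : 0 ≤ Nu)
    (hzu : z ≤ Pu) (hzv : z ≤ Pv) (hzw : z ≤ Pw)
    (hmu' : mu ≤ Pu) (hmvw' : mvw ≤ Pu) (hy₁ : y₁ ≤ Pu) (hy₂ : y₂ ≤ Pv) (hy₃ : y₃ ≤ Pw)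
    (hzuv : Pu * Pv ≤ z) (hzuw : Pu * Pw ≤ z)
    (b₁ : Nu * mvw ≤ x₁ * Pu) (c₁ : y₁ * Pu ≤ Nu * mu) (e₁ : (zv + zw) * Pu ≤ Nu * z)
    (b₂ : Nv * mv ≤ x₂ * Pv) (c₂ : y₂ * Pv ≤ Nv * muw) (e₂ : Nv * z ≤ zv * Pv)
    (b₃ : Nw * mw ≤ x₃ * Pw) (c₃ : y₃ * Pw ≤ Nw * muv) (e₃ : Nw * z ≤ zw * Pw)
    (hu : mu ≤ mvw) (hv : muw - mv ≤ mvw - mu) (hw : muv - mw ≤ mvw - mu) :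
    y₁ + y₂ + y₃ ≤ x₁ + x₂ + x₃ := by
  have hle : ∀ {P N m m' x y : ℝ}, 0 ≤ P → 0 ≤ N → 0 ≤ x → y ≤ P → N * m ≤ x * P →
      y * P ≤ N * m' → m' ≤ m → y ≤ x := by
    intro P N m m' x y hP hN hx hy hb hc hm
    rcases hP.eq_or_lt with rfl | hP
    · linarith
    · exact le_of_mul_le_mul_right ((hc.trans (mul_le_mul_of_nonneg_left hm hN)).trans hb) hP
  rcases hz.eq_or_lt with rfl | hz
  · rcases hPu.eq_or_lt with rfl | hPu
    · have := hle hPv hNv hx₂ hy₂ b₂ c₂ (by linarith)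
      have := hle hPw hNw hx₃ hy₃ b₃ c₃ (by linarith)
      linarith
    · have h1 : Pv ≤ 0 := by nlinarith
      have h2 : Pw ≤ 0 := by nlinarith
      have := hle hPu.le hNu hx₁ hy₁ b₁ c₁ hu
      linarith
  · have hPu : 0 < Pu := hz.trans_le hzu
    have hPv : 0 < Pv := hz.trans_le hzv
    have hPw : 0 < Pw := hz.trans_le hzw
    rw [← div_le_iff₀ hPu, mul_div_right_comm] at b₁
    rw [← div_le_iff₀ hPv, mul_div_right_comm] at b₂
    rw [← div_le_iff₀ hPw, mul_div_right_comm] at b₃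
    rw [← le_div_iff₀ hPu, mul_div_right_comm] at c₁
    rw [← le_div_iff₀ hPv, mul_div_right_comm] at c₂
    rw [← le_div_iff₀ hPw, mul_div_right_comm] at c₃
    rw [← le_div_iff₀ hPu, mul_div_right_comm] at e₁
    rw [← div_le_iff₀ hPv, mul_div_right_comm] at e₂
    rw [← div_le_iff₀ hPw, mul_div_right_comm] at e₃
    have hq : Nv / Pv + Nw / Pw ≤ Nu / Pu := by
      refine le_of_mul_le_mul_right ?_ hz
      linarith
    have hv0 : 0 ≤ Nv / Pv := by positivity
    have hw0 : 0 ≤ Nw / Pw := by positivity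
    nlinarith [mul_le_mul_of_nonneg_left hv hv0, mul_le_mul_of_nonneg_left hw hw0,
      mul_le_mul_of_nonneg_right hq (sub_nonneg.2 hu)]

theorem probOn_conn_le_of_max {G : PercGraph V E} (hp : G.ProbValid) (R : Finset E)
    (u v w b x : V)
    (hu : G.probOn R (fun X => G.Conn (conf X) b u ∧ ¬ G.Conn (conf X) b v ∧
        ¬ G.Conn (conf X) b w) ≤
      G.probOn R (fun X => G.Conn (conf X) b v ∧ G.Conn (conf X) b w ∧ ¬ G.Conn (conf X) b u))
    (hv : G.probOn R (fun X => G.Conn (conf X) b w ∧ G.Conn (conf X) b u ∧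
          ¬ G.Conn (conf X) b v) -
        G.probOn R (fun X => G.Conn (conf X) b v ∧ ¬ G.Conn (conf X) b w ∧
          ¬ G.Conn (conf X) b u) ≤
      G.probOn R (fun X => G.Conn (conf X) b v ∧ G.Conn (conf X) b w ∧ ¬ G.Conn (conf X) b u) -
        G.probOn R (fun X => G.Conn (conf X) b u ∧ ¬ G.Conn (conf X) b v ∧
          ¬ G.Conn (conf X) b w))
    (hw : G.probOn R (fun X => G.Conn (conf X) b u ∧ G.Conn (conf X) b v ∧
          ¬ G.Conn (conf X) b w) -
        G.probOn R (fun X => G.Conn (conf X) b w ∧ ¬ G.Conn (conf X) b u ∧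
          ¬ G.Conn (conf X) b v) ≤
      G.probOn R (fun X => G.Conn (conf X) b v ∧ G.Conn (conf X) b w ∧ ¬ G.Conn (conf X) b u) -
        G.probOn R (fun X => G.Conn (conf X) b u ∧ ¬ G.Conn (conf X) b v ∧
          ¬ G.Conn (conf X) b w)) :
    G.probOn R (fun X => (G.Conn (conf X) x u ∨ G.Conn (conf X) x v ∨ G.Conn (conf X) x w) ∧
        G.Conn (conf X) u b) ≤
      G.probOn R (fun X => G.Conn (conf X) x b ∧
        (G.Conn (conf X) x u ∨ G.Conn (conf X) x v ∨ G.Conn (conf X) x w)) := by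
  have sep₁ : ∀ v u w, G.Sep {v} {u, w} = fun X =>
      ¬ G.Conn (conf X) v u ∧ ¬ G.Conn (conf X) v w := by
    intros; ext; simp [Sep]
  have sep₂ : ∀ v u w, G.Sep {v, w} {u} = fun X =>
      ¬ G.Conn (conf X) v u ∧ ¬ G.Conn (conf X) w u := by
    intros; ext; simp [Sep]
  obtain ⟨b₁, c₁, e₁⟩ := pair_vs_single hp R u v w b x
  obtain ⟨b₂, c₂, e₂⟩ := single_vs_pair hp R u v w b x
  obtain ⟨b₃, c₃, e₃⟩ := single_vs_pair hp R u w v b x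
  have f₂ := sep_mul_sep_le hp R u v w
  have f₃ := sep_mul_sep_le hp R u w v
  simp only [sep₁, sep₂, not_not] at b₁ c₁ e₁ b₂ c₂ e₂ b₃ c₃ e₃ f₂ f₃
  clear sep₁ sep₂
  have sym : ∀ {X y z}, G.Conn (conf X) y z → G.Conn (conf X) z y := Conn.symm
  have tr : ∀ {X y z t}, G.Conn (conf X) y z → G.Conn (conf X) z t → G.Conn (conf X) y t :=
    Conn.trans
  have nn : ∀ U, 0 ≤ G.probOn R U := probOn_nonneg hp R
  have z₁ : G.probOn R (fun X => (¬ G.Conn (conf X) v u ∧ ¬ G.Conn (conf X) w u) ∧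
      ¬ G.Conn (conf X) v w) = G.probOn R (fun X => (¬ G.Conn (conf X) v u ∧
      ¬ G.Conn (conf X) v w) ∧ ¬ G.Conn (conf X) u w) :=
    probOn_congr fun X _ => by grind
  have z₃ : G.probOn R (fun X => (¬ G.Conn (conf X) w u ∧ ¬ G.Conn (conf X) w v) ∧
      ¬ G.Conn (conf X) u v) = G.probOn R (fun X => (¬ G.Conn (conf X) v u ∧
      ¬ G.Conn (conf X) v w) ∧ ¬ G.Conn (conf X) u w) :=
    probOn_congr fun X _ => by grind
  have hz : G.probOn R (fun X => ((¬ G.Conn (conf X) v u ∧ ¬ G.Conn (conf X) v w) ∧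
        G.Conn (conf X) x v) ∧ ¬ G.Conn (conf X) u w) +
      G.probOn R (fun X => ((¬ G.Conn (conf X) w u ∧ ¬ G.Conn (conf X) w v) ∧
        G.Conn (conf X) x w) ∧ ¬ G.Conn (conf X) u v) =
      G.probOn R (fun X => ((¬ G.Conn (conf X) v u ∧ ¬ G.Conn (conf X) w u) ∧
        (G.Conn (conf X) x v ∨ G.Conn (conf X) x w)) ∧ ¬ G.Conn (conf X) v w) := by
    rw [← probOn_add G R (fun X => ((¬ G.Conn (conf X) v u ∧ ¬ G.Conn (conf X) w u) ∧
      (G.Conn (conf X) x v ∨ G.Conn (conf X) x w)) ∧ ¬ G.Conn (conf X) v w)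
      (fun X => G.Conn (conf X) x v)]
    congr 1 <;> exact probOn_congr fun X _ => by grind
  rw [z₁, ← hz] at e₁
  rw [z₃] at e₃
  have key : G.probOn R (fun X => ((¬ G.Conn (conf X) v u ∧ ¬ G.Conn (conf X) w u) ∧
        (G.Conn (conf X) x v ∨ G.Conn (conf X) x w)) ∧ G.Conn (conf X) b u) +
      G.probOn R (fun X => ((¬ G.Conn (conf X) v u ∧ ¬ G.Conn (conf X) v w) ∧
        G.Conn (conf X) x v) ∧ G.Conn (conf X) b u ∧ G.Conn (conf X) b w) +
      G.probOn R (fun X => ((¬ G.Conn (conf X) w u ∧ ¬ G.Conn (conf X) w v) ∧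
        G.Conn (conf X) x w) ∧ G.Conn (conf X) b u ∧ G.Conn (conf X) b v) ≤
      G.probOn R (fun X => ((¬ G.Conn (conf X) v u ∧ ¬ G.Conn (conf X) w u) ∧
        (G.Conn (conf X) x v ∨ G.Conn (conf X) x w)) ∧ G.Conn (conf X) b v ∧
        G.Conn (conf X) b w) +
      G.probOn R (fun X => ((¬ G.Conn (conf X) v u ∧ ¬ G.Conn (conf X) v w) ∧
        G.Conn (conf X) x v) ∧ G.Conn (conf X) b v) +
      G.probOn R (fun X => ((¬ G.Conn (conf X) w u ∧ ¬ G.Conn (conf X) w v) ∧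
        G.Conn (conf X) x w) ∧ G.Conn (conf X) b w) := by
    have m₁ : G.probOn R (fun X => G.Conn (conf X) b u ∧ ¬ G.Conn (conf X) b v ∧
          ¬ G.Conn (conf X) b w) =
        G.probOn R (fun X => (¬ G.Conn (conf X) v u ∧ ¬ G.Conn (conf X) w u) ∧
          G.Conn (conf X) b u) := probOn_congr fun X _ => by grind
    have m₂ : G.probOn R (fun X => G.Conn (conf X) b v ∧ ¬ G.Conn (conf X) b w ∧
          ¬ G.Conn (conf X) b u) =
        G.probOn R (fun X => (¬ G.Conn (conf X) v u ∧ ¬ G.Conn (conf X) v w) ∧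
          G.Conn (conf X) b v) := probOn_congr fun X _ => by grind
    have m₃ : G.probOn R (fun X => G.Conn (conf X) b w ∧ ¬ G.Conn (conf X) b u ∧
          ¬ G.Conn (conf X) b v) =
        G.probOn R (fun X => (¬ G.Conn (conf X) w u ∧ ¬ G.Conn (conf X) w v) ∧
          G.Conn (conf X) b w) := probOn_congr fun X _ => by grind
    have m₂₃ : G.probOn R (fun X => G.Conn (conf X) b v ∧ G.Conn (conf X) b w ∧
          ¬ G.Conn (conf X) b u) =
        G.probOn R (fun X => (¬ G.Conn (conf X) v u ∧ ¬ G.Conn (conf X) w u) ∧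
          G.Conn (conf X) b v ∧ G.Conn (conf X) b w) := probOn_congr fun X _ => by grind
    have m₁₃ : G.probOn R (fun X => G.Conn (conf X) b w ∧ G.Conn (conf X) b u ∧
          ¬ G.Conn (conf X) b v) =
        G.probOn R (fun X => (¬ G.Conn (conf X) v u ∧ ¬ G.Conn (conf X) v w) ∧
          G.Conn (conf X) b u ∧ G.Conn (conf X) b w) := probOn_congr fun X _ => by grind
    have m₁₂ : G.probOn R (fun X => G.Conn (conf X) b u ∧ G.Conn (conf X) b v ∧
          ¬ G.Conn (conf X) b w) =
        G.probOn R (fun X => (¬ G.Conn (conf X) w u ∧ ¬ G.Conn (conf X) w v) ∧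
          G.Conn (conf X) b u ∧ G.Conn (conf X) b v) := probOn_congr fun X _ => by grind
    have f₃' : G.probOn R (fun X => ¬ G.Conn (conf X) v u ∧ ¬ G.Conn (conf X) w u) *
          G.probOn R (fun X => ¬ G.Conn (conf X) w u ∧ ¬ G.Conn (conf X) w v) ≤
        G.probOn R (fun X => (¬ G.Conn (conf X) v u ∧ ¬ G.Conn (conf X) v w) ∧
          ¬ G.Conn (conf X) u w) := by
      have h : G.probOn R (fun X => ¬ G.Conn (conf X) v u ∧ ¬ G.Conn (conf X) w u) =
        G.probOn R (fun X => ¬ G.Conn (conf X) w u ∧ ¬ G.Conn (conf X) v u) :=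
        probOn_congr fun X _ => and_comm
      rw [h]
      refine f₃.trans (probOn_mono hp fun X _ => ?_)
      clear * - sym tr
      grind
    rw [m₁, m₂₃] at hu
    rw [m₁, m₂, m₁₃, m₂₃] at hv
    rw [m₁, m₃, m₁₂, m₂₃] at hw
    refine sum_le_sum_of_ratio_bounds (nn _) (nn _) (nn _) (nn _) (nn _) (nn _)
      (nn _) (nn _) (nn _) (nn _) (nn _) ?_ ?_ ?_ ?_ ?_ ?_ ?_ ?_ (f₂.trans ?_) f₃'
      b₁ c₁ e₁ b₂ c₂ e₂ b₃ c₃ e₃ hu hv hw <;>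
    · refine probOn_mono hp fun X _ => ?_
      clear * - sym tr
      grind
  set A : Finset E → Prop := fun X =>
    G.Conn (conf X) x u ∨ G.Conn (conf X) x v ∨ G.Conn (conf X) x w with hA
  have s₁ := probOn_add G R (fun X => A X ∧ G.Conn (conf X) u b) (fun X => G.Conn (conf X) x b)
  have s₂ := probOn_add G R (fun X => G.Conn (conf X) x b ∧ A X) (fun X => G.Conn (conf X) u b)
  have s₃ : G.probOn R (fun X => (A X ∧ G.Conn (conf X) u b) ∧ G.Conn (conf X) x b) =
      G.probOn R (fun X => (G.Conn (conf X) x b ∧ A X) ∧ G.Conn (conf X) u b) :=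
    probOn_congr fun X _ => by tauto
  have t₁ := probOn_add G R (fun X => (A X ∧ G.Conn (conf X) u b) ∧ ¬ G.Conn (conf X) x b)
    (fun X => G.Conn (conf X) b v)
  have t₂ := probOn_add G R (fun X => ((A X ∧ G.Conn (conf X) u b) ∧ ¬ G.Conn (conf X) x b) ∧
    ¬ G.Conn (conf X) b v) (fun X => G.Conn (conf X) b w)
  have t₃ := probOn_add G R (fun X => (G.Conn (conf X) x b ∧ A X) ∧ ¬ G.Conn (conf X) u b)
    (fun X => G.Conn (conf X) b v)
  have t₄ := probOn_add G R (fun X => ((G.Conn (conf X) x b ∧ A X) ∧ ¬ G.Conn (conf X) u b) ∧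
    G.Conn (conf X) b v) (fun X => G.Conn (conf X) b w)
  have y₁ : G.probOn R (fun X => (((A X ∧ G.Conn (conf X) u b) ∧ ¬ G.Conn (conf X) x b) ∧
        ¬ G.Conn (conf X) b v) ∧ ¬ G.Conn (conf X) b w) ≤
      G.probOn R (fun X => ((¬ G.Conn (conf X) v u ∧ ¬ G.Conn (conf X) w u) ∧
        (G.Conn (conf X) x v ∨ G.Conn (conf X) x w)) ∧ G.Conn (conf X) b u) := by
    refine probOn_mono hp fun X _ => ?_
    clear * - sym tr hA
    grind
  have y₂ : G.probOn R (fun X => (((A X ∧ G.Conn (conf X) u b) ∧ ¬ G.Conn (conf X) x b) ∧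
        ¬ G.Conn (conf X) b v) ∧ G.Conn (conf X) b w) ≤
      G.probOn R (fun X => ((¬ G.Conn (conf X) v u ∧ ¬ G.Conn (conf X) v w) ∧
        G.Conn (conf X) x v) ∧ G.Conn (conf X) b u ∧ G.Conn (conf X) b w) := by
    refine probOn_mono hp fun X _ => ?_
    clear * - sym tr hA
    grind
  have y₃ : G.probOn R (fun X => ((A X ∧ G.Conn (conf X) u b) ∧ ¬ G.Conn (conf X) x b) ∧
        G.Conn (conf X) b v) ≤
      G.probOn R (fun X => ((¬ G.Conn (conf X) w u ∧ ¬ G.Conn (conf X) w v) ∧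
        G.Conn (conf X) x w) ∧ G.Conn (conf X) b u ∧ G.Conn (conf X) b v) := by
    refine probOn_mono hp fun X _ => ?_
    clear * - sym tr hA
    grind
  have x₁ : G.probOn R (fun X => ((¬ G.Conn (conf X) v u ∧ ¬ G.Conn (conf X) w u) ∧
        (G.Conn (conf X) x v ∨ G.Conn (conf X) x w)) ∧ G.Conn (conf X) b v ∧
        G.Conn (conf X) b w) ≤
      G.probOn R (fun X => (((G.Conn (conf X) x b ∧ A X) ∧ ¬ G.Conn (conf X) u b) ∧
        G.Conn (conf X) b v) ∧ G.Conn (conf X) b w) := by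
    refine probOn_mono hp fun X _ => ?_
    clear * - sym tr hA
    grind
  have x₂ : G.probOn R (fun X => ((¬ G.Conn (conf X) v u ∧ ¬ G.Conn (conf X) v w) ∧
        G.Conn (conf X) x v) ∧ G.Conn (conf X) b v) ≤
      G.probOn R (fun X => (((G.Conn (conf X) x b ∧ A X) ∧ ¬ G.Conn (conf X) u b) ∧
        G.Conn (conf X) b v) ∧ ¬ G.Conn (conf X) b w) := by
    refine probOn_mono hp fun X _ => ?_
    clear * - sym tr hA
    grind
  have x₃ : G.probOn R (fun X => ((¬ G.Conn (conf X) w u ∧ ¬ G.Conn (conf X) w v) ∧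
        G.Conn (conf X) x w) ∧ G.Conn (conf X) b w) ≤
      G.probOn R (fun X => ((G.Conn (conf X) x b ∧ A X) ∧ ¬ G.Conn (conf X) u b) ∧
        ¬ G.Conn (conf X) b v) := by
    refine probOn_mono hp fun X _ => ?_
    clear * - sym tr hA
    grind
  linarith

end ThreePoints

end PercGraph

/-- pre-FKG inequality for `|A| = 3` under the hypothesis
`m_{j} ≤ m_{{1,2,3}∖{j}}` for some `j`, where `m_S` is the probability that the
cluster of `b` meets `A` exactly in `A(S)`. -/
theorem preFKG_three_m
    {V E : Type} [DecidableEq V] [Fintype E] [DecidableEq E]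
    (G : PercGraph V E) (hp : G.ProbValid) (a : Fin 3 → V) (b : V)
    (m : Finset (Fin 3) → ℝ)
    (hm : ∀ S, m S =
      G.prob {ω | (∀ s ∈ S, G.Conn ω b (a s)) ∧ ∀ t ∉ S, ¬ G.Conn ω b (a t)})
    (hj : ∃ j : Fin 3, m {j} ≤ m {j}ᶜ) (x₀ : V) :
    min (min (G.prob (G.connTo x₀ (Set.range a) ∩ G.connEvent (a 0) b))
             (G.prob (G.connTo x₀ (Set.range a) ∩ G.connEvent (a 1) b)))
        (G.prob (G.connTo x₀ (Set.range a) ∩ G.connEvent (a 2) b))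
      ≤ G.prob (G.connEvent x₀ b ∩ G.connTo x₀ (Set.range a)) := by
  have hmP : ∀ S, m S = G.probOn Finset.univ (fun X =>
      (∀ s ∈ S, G.Conn (PercGraph.conf X) b (a s)) ∧
        ∀ t ∉ S, ¬ G.Conn (PercGraph.conf X) b (a t)) :=
    fun S => (hm S).trans (G.prob_eq_probOn _)
  have single : ∀ i j k : Fin 3, (∀ l, l ≠ i ↔ l = j ∨ l = k) → m {i} =
      G.probOn Finset.univ (fun X => G.Conn (PercGraph.conf X) b (a i) ∧
        ¬ G.Conn (PercGraph.conf X) b (a j) ∧ ¬ G.Conn (PercGraph.conf X) b (a k)) := by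
    intro i j k h
    simp only [hmP, Finset.mem_singleton, h, forall_eq_or_imp, forall_eq]
  have pair : ∀ i j k : Fin 3, (∀ l, l ≠ i ↔ l = j ∨ l = k) → m {i}ᶜ =
      G.probOn Finset.univ (fun X => G.Conn (PercGraph.conf X) b (a j) ∧
        G.Conn (PercGraph.conf X) b (a k) ∧ ¬ G.Conn (PercGraph.conf X) b (a i)) := by
    intro i j k h
    simp only [hmP, Finset.mem_compl, Finset.mem_singleton, not_not, forall_eq]
    simp only [h, forall_eq_or_imp, forall_eq, and_assoc]
  have bound : ∀ i j k : Fin 3, (∀ l, l ≠ i ↔ l = j ∨ l = k) →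
      (∀ l, l ≠ j ↔ l = k ∨ l = i) → (∀ l, l ≠ k ↔ l = i ∨ l = j) →
      m {i} ≤ m {i}ᶜ → m {j}ᶜ - m {j} ≤ m {i}ᶜ - m {i} → m {k}ᶜ - m {k} ≤ m {i}ᶜ - m {i} →
      G.prob (G.connTo x₀ (Set.range a) ∩ G.connEvent (a i) b) ≤
        G.prob (G.connEvent x₀ b ∩ G.connTo x₀ (Set.range a)) := by
    intro i j k hi hj hk h₁ h₂ h₃
    rw [single i j k hi, pair i j k hi] at h₁ h₂ h₃
    rw [single j k i hj, pair j k i hj] at h₂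
    rw [single k i j hk, pair k i j hk] at h₃
    have key := PercGraph.probOn_conn_le_of_max hp Finset.univ (a i) (a j) (a k) b x₀ h₁ h₂ h₃
    have hA : ∀ ω, ω ∈ G.connTo x₀ (Set.range a) ↔
        G.Conn ω x₀ (a i) ∨ G.Conn ω x₀ (a j) ∨ G.Conn ω x₀ (a k) := by
      intro ω
      have hall : ∀ l, l = i ∨ l = j ∨ l = k := fun l => by
        rw [← hi l]
        exact em _
      simp only [PercGraph.connTo, Set.mem_ofPred_eq, Set.exists_range_iff]
      constructor
      · rintro ⟨l, hl⟩
        rcases hall l with rfl | rfl | rfl <;> tauto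
      · rintro (h | h | h) <;> exact ⟨_, h⟩
    rw [G.prob_eq_probOn, G.prob_eq_probOn]
    simpa only [Set.mem_inter_iff, hA, PercGraph.connEvent, Set.mem_ofPred_eq] using key
  obtain ⟨i, hi⟩ := Finite.exists_max fun i : Fin 3 => m {i}ᶜ - m {i}
  obtain ⟨j, hj⟩ := hj
  have hi0 : m {i} ≤ m {i}ᶜ := by linarith [hi j]
  fin_cases i
  · exact (min_le_left _ _).trans ((min_le_left _ _).trans
      (bound 0 1 2 (by decide) (by decide) (by decide) hi0 (hi 1) (hi 2)))
  · exact (min_le_left _ _).trans ((min_le_right _ _).trans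
      (bound 1 2 0 (by decide) (by decide) (by decide) hi0 (hi 2) (hi 0)))
  · exact (min_le_right _ _).trans
      (bound 2 0 1 (by decide) (by decide) (by decide) hi0 (hi 0) (hi 1))
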